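/- arXiv:2306.08069 — 3 statements merged into one kernel-verified Lean document; each statement's English description precedes it below -/
import Mathlib

section
/- Let n, m ≥ 0 be integers with 2n+m ≥ 2, and let G be a finite simple graph with χ_{n,m}(G) = k. Then the arboricity of G satisfies arb(G) ≤ ⌈log_{2n+m} k + k/2⌉. -/
open SimpleGraph

/-- The involution pairing the label of an arc with the label of the corresponding
reverse arc: for `1 ≤ k ≤ 2n`, the labels `2i` (arc of type `i`) and `2i-1`
(reverse arc of type `i`) are swapped; edge labels `2n+1, …, 2n+m` are fixed. -/
def conjLab (n k : ℕ) : ℕ :=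
  if k ≤ 2 * n then (if k % 2 = 0 then k - 1 else k + 1) else k

/-- An `(n,m)`-graph: a simple underlying graph together with a labelling of each
ordered pair of adjacent vertices by a number in `{1, …, 2n+m}` (`lab u v = α`
means that `v` is an `α`-neighbor of `u`), compatible with reversal. -/
structure NMGraph (n m : ℕ) (V : Type) where
  und : SimpleGraph V
  lab : V → V → ℕ
  lab_mem : ∀ u v, und.Adj u v → 1 ≤ lab u v ∧ lab u v ≤ 2 * n + m
  lab_conj : ∀ u v, und.Adj u v → lab v u = conjLab n (lab u v)

/-- `N^α(u)`, the set of `α`-neighbors of `u`. -/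
def NMGraph.nbr {n m : ℕ} {V : Type} (G : NMGraph n m V) (α : ℕ) (u : V) : Set V :=
  {v | G.und.Adj u v ∧ G.lab u v = α}

/-- `G → H`: existence of a homomorphism of `(n,m)`-graphs, i.e. a vertex map
preserving adjacency together with the type (and direction) of every arc/edge. -/
def NMGraph.HomTo {n m : ℕ} {V W : Type} (G : NMGraph n m V) (H : NMGraph n m W) : Prop :=
  ∃ f : V → W, ∀ u v, G.und.Adj u v →
    H.und.Adj (f u) (f v) ∧ H.lab (f u) (f v) = G.lab u v

/-- The `(n,m)`-chromatic number of an `(n,m)`-graph: the least number of vertices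
of a target of a homomorphism. -/
noncomputable def nmChrom (n m : ℕ) {V : Type} (G : NMGraph n m V) : ℕ :=
  sInf {t | ∃ H : NMGraph n m (Fin t), G.HomTo H}

/-- The arboricity of a simple graph: the least `r` such that the edge set can be
partitioned into `r` forests. -/
noncomputable def arboricity {V : Type} (G : SimpleGraph V) : ℕ :=
  sInf {r | ∃ F : Fin r → SimpleGraph V,
    (∀ i, (F i).IsAcyclic) ∧
    (∀ u v, G.Adj u v ↔ ∃ i, (F i).Adj u v) ∧
    (∀ i j u v, (F i).Adj u v → (F j).Adj u v → i = j)}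

/-- The `(n,m)`-chromatic number of a simple graph: the maximum of `nmChrom` over
all `(n,m)`-graphs with that underlying graph. -/
noncomputable def nmChromGraph (n m : ℕ) {V : Type} (S : SimpleGraph V) : ℕ :=
  sSup {k | ∃ G : NMGraph n m V, G.und = S ∧ nmChrom n m G = k}

namespace SimpleGraph

/-- The edges of `G` with both ends in `U`. -/
def edgesIn {V : Type*} (G : SimpleGraph V) (U : Set V) : Set (Sym2 V) :=
  {e ∈ G.edgeSet | ∀ x ∈ e, x ∈ U}

/-- The subgraph formed by the edges of colour `i`. -/
def colorClass {V ι : Type*} (G : SimpleGraph V) (c : Sym2 V → ι) (i : ι) : SimpleGraph V where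
  Adj u v := G.Adj u v ∧ c s(u, v) = i
  symm := ⟨fun u v h => ⟨h.1.symm, by rw [Sym2.eq_swap]; exact h.2⟩⟩
  loopless := ⟨fun u h => G.loopless.irrefl u h.1⟩

section Basic

variable {V ι : Type*} {G : SimpleGraph V}

theorem edgesIn_eq_image_induce (G : SimpleGraph V) (U : Set V) :
    G.edgesIn U = Sym2.map Subtype.val '' (G.induce U).edgeSet := by
  ext e
  constructor
  · induction e with | _ u v
    rintro ⟨h, hU⟩
    exact ⟨s(⟨u, hU u (by simp)⟩, ⟨v, hU v (by simp)⟩), by simpa using h, by simp⟩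
  · rintro ⟨e, he, rfl⟩
    induction e with | _ u v
    refine ⟨by simpa using he, ?_⟩
    simp

theorem ncard_edgesIn (G : SimpleGraph V) (U : Set V) :
    (G.edgesIn U).ncard = Nat.card (G.induce U).edgeSet := by
  rw [edgesIn_eq_image_induce,
    Set.ncard_image_of_injective _ (Sym2.map.injective Subtype.val_injective)]
  rfl

theorem ncard_edgesIn_le_choose_two [Finite V] (G : SimpleGraph V) (U : Set V) :
    (G.edgesIn U).ncard ≤ U.ncard.choose 2 := by
  classical
  have := Fintype.ofFinite V
  rw [ncard_edgesIn, Nat.card_eq_fintype_card, ← edgeFinset_card, Set.ncard_def,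
    Set.encard, ENat.card_eq_coe_natCard, Nat.card_eq_fintype_card]
  exact card_edgeFinset_le_card_choose_two

theorem ncard_le_ncard_edgesIn_add_one {U : Set V} (h : (G.induce U).Connected) :
    U.ncard ≤ (G.edgesIn U).ncard + 1 := by
  rw [ncard_edgesIn]
  exact h.card_vert_le_card_edgeSet_add_one

theorem IsAcyclic.not_reachable_deleteEdges {u v : V} (hG : G.IsAcyclic) (p : G.Path u v)
    {e : Sym2 V} (he : e ∈ p.1.edges) : ¬ (G.deleteEdges {e}).Reachable u v := by
  classical
  rintro ⟨q⟩
  have hle : G.deleteEdges {e} ≤ G := deleteEdges_le _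
  have hp : p = ⟨q.toPath.1.mapLe hle, (Walk.isPath_mapLe hle).2 q.toPath.2⟩ :=
    (hG.subsingleton_path u v).elim _ _
  rw [hp] at he
  simp only [Walk.edges_mapLe_eq_edges] at he
  have := Walk.edges_subset_edgeSet _ he
  simp at this

theorem reachable_of_forall_adj {H K : SimpleGraph V}
    (h : ∀ ⦃u v⦄, H.Adj u v → K.Reachable u v) {u v : V} (huv : H.Reachable u v) :
    K.Reachable u v := by
  obtain ⟨p⟩ := huv
  induction p with
  | nil => exact Reachable.refl _
  | cons hadj _ ih => exact (h hadj).trans ih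

end Basic

section NashWilliams

variable {V ι : Type*}

/-- A state consists of a colouring and one edge that is left uncoloured; this is the graph of
the remaining edges of colour `i`. -/
def stateClass (G : SimpleGraph V) (s : (Sym2 V → ι) × Sym2 V) (i : ι) : SimpleGraph V :=
  (G.deleteEdges {s.2}).colorClass s.1 i

/-- All colour classes of the state are forests. -/
def IsForestState (G : SimpleGraph V) (s : (Sym2 V → ι) × Sym2 V) : Prop :=
  s.2 ∈ G.edgeSet ∧ ∀ i, (G.stateClass s i).IsAcyclic

/-- The uncoloured edge takes the place, and the colour, of another edge. -/
def Exchange (G : SimpleGraph V) (s t : (Sym2 V → ι) × Sym2 V) : Prop :=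
  G.IsForestState t ∧ ∃ i, t.1 = open Classical in Function.update s.1 s.2 i

/-- The edges that can be made the uncoloured one by a sequence of exchanges. -/
def exchangeable (G : SimpleGraph V) (s : (Sym2 V → ι) × Sym2 V) : Set (Sym2 V) :=
  {e | ∃ t, Relation.ReflTransGen G.Exchange s t ∧ t.2 = e}

variable {G : SimpleGraph V} {s t s₀ : (Sym2 V → ι) × Sym2 V}

theorem stateClass_adj {i : ι} {u v : V} :
    (G.stateClass s i).Adj u v ↔ (G.Adj u v ∧ s(u, v) ≠ s.2) ∧ s.1 s(u, v) = i := by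
  simp [stateClass, colorClass]

theorem IsForestState.of_reflTransGen (hs : G.IsForestState s)
    (h : Relation.ReflTransGen G.Exchange s t) : G.IsForestState t := by
  induction h with
  | refl => exact hs
  | tail _ h _ => exact h.1

theorem IsForestState.reachable (hG : ∀ c : Sym2 V → ι, ∃ i, ¬ (G.colorClass c i).IsAcyclic)
    (hs : G.IsForestState s) {u v : V} (huv : s.2 = s(u, v)) (i : ι) :
    (G.stateClass s i).Reachable u v := by
  classical
  by_contra hn
  obtain ⟨j, hj⟩ := hG (Function.update s.1 s.2 i)
  apply hj
  by_cases hij : i = j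
  · subst hij
    refine ((hs.2 i).sup_edge_of_not_reachable hn).anti ?_
    rintro x y ⟨h1, h2⟩
    by_cases hxy : s(x, y) = s.2
    · right
      rw [edge_adj]
      rw [huv] at hxy
      exact ⟨by simpa using hxy, h1.ne⟩
    · left
      rw [Function.update_of_ne hxy] at h2
      exact stateClass_adj.2 ⟨⟨h1, hxy⟩, h2⟩
  · refine (hs.2 j).anti ?_
    rintro x y ⟨h1, h2⟩
    have hxy : s(x, y) ≠ s.2 := by
      rintro h
      rw [h] at h2
      simp [hij] at h2
    rw [Function.update_of_ne hxy] at h2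
    exact stateClass_adj.2 ⟨⟨h1, hxy⟩, h2⟩

theorem IsForestState.exchange [DecidableEq (Sym2 V)] (hs : G.IsForestState s) {u v : V}
    (huv : s.2 = s(u, v)) {i : ι} (p : (G.stateClass s i).Path u v) {e : Sym2 V}
    (he : e ∈ p.1.edges) : G.Exchange s (Function.update s.1 s.2 i, e) := by
  have heK : e ∈ (G.stateClass s i).edgeSet := Walk.edges_subset_edgeSet _ he
  refine ⟨⟨?_, fun j => ?_⟩, i, by congr!⟩
  · induction e with | _ x y
    exact (stateClass_adj.1 heK).1.1
  by_cases hij : i = j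
  · subst hij
    refine (((hs.2 i).anti (deleteEdges_le {e})).sup_edge_of_not_reachable
      ((hs.2 i).not_reachable_deleteEdges p he)).anti ?_
    intro x y h
    obtain ⟨⟨h1, h3⟩, h2⟩ := stateClass_adj.1 h
    by_cases hxy : s(x, y) = s.2
    · right
      rw [edge_adj]
      rw [huv] at hxy
      exact ⟨by simpa using hxy, h1.ne⟩
    · left
      simp only [Function.update_of_ne hxy] at h2
      exact deleteEdges_adj.2 ⟨stateClass_adj.2 ⟨⟨h1, hxy⟩, h2⟩, h3⟩
  · refine (hs.2 j).anti ?_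
    intro x y h
    obtain ⟨⟨h1, h3⟩, h2⟩ := stateClass_adj.1 h
    have hxy : s(x, y) ≠ s.2 := by
      rintro h
      rw [h] at h2
      simp [hij] at h2
    simp only [Function.update_of_ne hxy] at h2
    exact stateClass_adj.2 ⟨⟨h1, hxy⟩, h2⟩

theorem reachable_inf_exchangeable_of_eq
    (hG : ∀ c : Sym2 V → ι, ∃ i, ¬ (G.colorClass c i).IsAcyclic)
    (hs₀ : G.IsForestState s₀) (hs : Relation.ReflTransGen G.Exchange s₀ s) {u v : V}
    (huv : s.2 = s(u, v)) (i : ι) :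
    (G.stateClass s i ⊓ fromEdgeSet (G.exchangeable s₀)).Reachable u v := by
  classical
  have hs' := hs₀.of_reflTransGen hs
  obtain ⟨p⟩ := hs'.reachable hG huv i
  refine ⟨p.toPath.1.transfer _ fun e he => ?_⟩
  have hK : e ∈ (G.stateClass s i).edgeSet := Walk.edges_subset_edgeSet _ he
  have hE : e ∈ G.exchangeable s₀ := ⟨_, hs.tail (hs'.exchange huv p.toPath he), rfl⟩
  induction e with | _ x y
  exact ⟨hK, (fromEdgeSet_adj _).2 ⟨hE, Adj.ne (mem_edgeSet _ |>.1 hK)⟩⟩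

theorem reachable_inf_exchangeable_of_exchange
    (hG : ∀ c : Sym2 V → ι, ∃ i, ¬ (G.colorClass c i).IsAcyclic)
    (hs₀ : G.IsForestState s₀) (hs : Relation.ReflTransGen G.Exchange s₀ s)
    (hst : G.Exchange s t) {i : ι} {u v : V}
    (h : (G.stateClass t i ⊓ fromEdgeSet (G.exchangeable s₀)).Reachable u v) :
    (G.stateClass s i ⊓ fromEdgeSet (G.exchangeable s₀)).Reachable u v := by
  classical
  refine reachable_of_forall_adj (fun x y hxy => ?_) h
  by_cases hs2 : s.2 = s(x, y)
  · exact reachable_inf_exchangeable_of_eq hG hs₀ hs hs2 i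
  · obtain ⟨-, j, hj⟩ := hst
    obtain ⟨h1, h2⟩ := hxy
    rw [stateClass_adj, hj, Function.update_of_ne (Ne.symm hs2)] at h1
    exact Adj.reachable ⟨stateClass_adj.2 ⟨⟨h1.1.1, Ne.symm hs2⟩, h1.2⟩, h2⟩

theorem reachable_inf_exchangeable
    (hG : ∀ c : Sym2 V → ι, ∃ i, ¬ (G.colorClass c i).IsAcyclic)
    (hs₀ : G.IsForestState s₀) {i : ι} {u v : V}
    (h : (fromEdgeSet (G.exchangeable s₀)).Reachable u v) :
    (G.stateClass s₀ i ⊓ fromEdgeSet (G.exchangeable s₀)).Reachable u v := by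
  refine reachable_of_forall_adj (fun x y hxy => ?_) h
  obtain ⟨⟨t, ht, hte⟩, -⟩ := (fromEdgeSet_adj _).1 hxy
  have := reachable_inf_exchangeable_of_eq hG hs₀ ht hte i
  clear hte
  induction ht with
  | refl => exact this
  | tail hs hst ih => exact ih (reachable_inf_exchangeable_of_exchange hG hs₀ hs hst this)

theorem exists_lt_ncard_edgesIn [Finite V] [Fintype ι]
    (hG : ∀ c : Sym2 V → ι, ∃ i, ¬ (G.colorClass c i).IsAcyclic) (hs : G.IsForestState s) :
    ∃ U : Set V, U.Nonempty ∧ Fintype.card ι * (U.ncard - 1) < (G.edgesIn U).ncard := by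
  classical
  obtain ⟨c, e⟩ := s
  induction e with | _ a b
  set H := fromEdgeSet (G.exchangeable (c, s(a, b))) with hH
  set K := fun i => G.stateClass (c, s(a, b)) i ⊓ H with hK
  set U : Set V := {y | H.Reachable a y} with hU
  have hab : H.Adj a b := (fromEdgeSet_adj _).2 ⟨⟨_, .refl, rfl⟩, Adj.ne hs.1⟩
  have hcard : ∀ i, U.ncard - 1 ≤ ((K i).edgesIn U).ncard := by
    intro i
    have hsupp : U = ((K i).connectedComponentMk a).supp := by
      ext y
      simp only [hU, Set.mem_ofPred_eq, ConnectedComponent.mem_supp_iff, ConnectedComponent.eq]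
      exact ⟨fun h => (reachable_inf_exchangeable hG hs h).symm,
        fun h => (h.mono inf_le_right).symm⟩
    have := ncard_le_ncard_edgesIn_add_one (G := K i) (U := U)
      (hsupp ▸ ((K i).connectedComponentMk a).connected_toSimpleGraph)
    omega
  have hdisj : Pairwise (Function.onFun Disjoint fun i => (K i).edgesIn U) := by
    intro i j hij
    refine Set.disjoint_left.2 fun e hi hj => hij ?_
    induction e with | _ x y
    exact (stateClass_adj.1 hi.1.1).2.symm.trans (stateClass_adj.1 hj.1.1).2
  have hsub : insert s(a, b) (⋃ i, (K i).edgesIn U) ⊆ G.edgesIn U := by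
    refine Set.insert_subset ⟨hs.1, ?_⟩ (Set.iUnion_subset fun i e he => ⟨?_, he.2⟩)
    · intro x hx
      rcases Sym2.mem_iff.1 hx with rfl | rfl
      · exact Reachable.refl _
      · exact hab.reachable
    · induction e with | _ x y
      exact (stateClass_adj.1 he.1.1).1.1
  have hnot : s(a, b) ∉ ⋃ i, (K i).edgesIn U := by
    simp only [Set.mem_iUnion, not_exists]
    exact fun i h => (stateClass_adj.1 h.1.1).1.2 rfl
  refine ⟨U, ⟨a, Reachable.refl _⟩, ?_⟩
  have hle := Set.ncard_le_ncard hsub (Set.toFinite _)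
  rw [Set.ncard_insert_of_notMem hnot (Set.toFinite _),
    Set.ncard_iUnion_of_finite (fun _ => Set.toFinite _) hdisj,
    finsum_eq_sum_of_fintype] at hle
  have := Finset.sum_le_sum fun i (_ : i ∈ Finset.univ) => hcard i
  rw [Finset.sum_const, Finset.card_univ, smul_eq_mul] at this
  omega

/-- **Nash-Williams' theorem** on forest decompositions. -/
theorem exists_colorClass_isAcyclic [Finite V] [Fintype ι] [Nonempty ι] (G : SimpleGraph V)
    (hG : ∀ U : Set V, U.Nonempty → (G.edgesIn U).ncard ≤ Fintype.card ι * (U.ncard - 1)) :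
    ∃ c : Sym2 V → ι, ∀ i, (G.colorClass c i).IsAcyclic := by
  classical
  induction G using WellFoundedLT.induction with | _ G ih
  by_cases hbot : G = ⊥
  · subst hbot
    exact ⟨fun _ => Classical.arbitrary ι,
      fun i => isAcyclic_bot.anti fun x y h => h.1⟩
  obtain ⟨e, he⟩ := edgeSet_nonempty.2 hbot
  have hlt : G.deleteEdges {e} < G := by
    refine lt_of_le_of_ne (deleteEdges_le _) fun h => ?_
    rw [← h] at he
    simp at he
  obtain ⟨c, hc⟩ := ih _ hlt fun U hU => (Set.ncard_le_ncard
    (show (G.deleteEdges {e}).edgesIn U ⊆ G.edgesIn U from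
      fun d hd => ⟨edgeSet_mono hlt.le hd.1, hd.2⟩) (Set.toFinite _)).trans (hG U hU)
  by_contra! hn
  obtain ⟨U, hU, hlt⟩ := exists_lt_ncard_edgesIn hn (s := (c, e)) ⟨he, hc⟩
  exact hlt.not_ge (hG U hU)

end NashWilliams

end SimpleGraph

theorem arboricity_le {V : Type} [Finite V] (S : SimpleGraph V) (r : ℕ)
    (h : ∀ U : Set V, U.Nonempty → (S.edgesIn U).ncard ≤ r * (U.ncard - 1)) :
    arboricity S ≤ r := by
  apply Nat.sInf_le
  obtain rfl | hr := Nat.eq_zero_or_pos r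
  · refine ⟨Fin.elim0, fun i => i.elim0, fun u v => ⟨fun huv => ?_, fun ⟨i, _⟩ => i.elim0⟩,
      fun i => i.elim0⟩
    have h0 := h Set.univ ⟨u, trivial⟩
    rw [Nat.zero_mul, Nat.le_zero, Set.ncard_eq_zero (Set.toFinite _)] at h0
    have : s(u, v) ∈ S.edgesIn Set.univ := ⟨huv, fun _ _ => trivial⟩
    simp [h0] at this
  · have : Nonempty (Fin r) := ⟨⟨0, hr⟩⟩
    obtain ⟨c, hc⟩ := S.exists_colorClass_isAcyclic (ι := Fin r) (by simpa using h)
    exact ⟨S.colorClass c, hc, fun u v => ⟨fun h => ⟨_, h, rfl⟩, fun ⟨_, h⟩ => h.1⟩,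
      fun i j u v hi hj => hi.2.symm.trans hj.2⟩

theorem conjLab_mem {n m a : ℕ} (h : 1 ≤ a ∧ a ≤ 2 * n + m) :
    1 ≤ conjLab n a ∧ conjLab n a ≤ 2 * n + m := by
  unfold conjLab
  split_ifs <;> omega

theorem conjLab_conjLab {n a : ℕ} (h : 1 ≤ a) : conjLab n (conjLab n a) = a := by
  unfold conjLab
  split_ifs <;> omega

/-- The `(n,m)`-graph on `S` in which the edge `uv` gets the label `a s(u, v) + 1` when read from
its smaller to its larger end. -/
noncomputable def NMGraph.ofLabels {n m : ℕ} {V : Type} [LinearOrder V] (S : SimpleGraph V)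
    (a : Sym2 V → Fin (2 * n + m)) : NMGraph n m V where
  und := S
  lab u v := if u < v then a s(u, v) + 1 else conjLab n (a s(u, v) + 1)
  lab_mem u v _ := by
    have h : 1 ≤ (a s(u, v) + 1 : ℕ) ∧ (a s(u, v) + 1 : ℕ) ≤ 2 * n + m := by omega
    split_ifs
    exacts [h, conjLab_mem h]
  lab_conj u v h := by
    rw [Sym2.eq_swap (a := v)]
    rcases lt_or_gt_of_ne h.ne with huv | huv
    · rw [if_neg huv.not_gt, if_pos huv]
    · rw [if_pos huv, if_neg huv.not_gt, conjLab_conjLab (by omega)]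

theorem NMGraph.ofLabels_lab_inj {n m : ℕ} {V : Type} [LinearOrder V] {S : SimpleGraph V}
    {a b : Sym2 V → Fin (2 * n + m)} {u v : V}
    (h : (NMGraph.ofLabels S a).lab u v = (NMGraph.ofLabels S b).lab u v) :
    a s(u, v) = b s(u, v) := by
  simp only [NMGraph.ofLabels] at h
  split_ifs at h
  · omega
  · have h' := congrArg (conjLab n) h
    rw [conjLab_conjLab (by omega), conjLab_conjLab (by omega)] at h'
    omega

theorem NMGraph.exists_homTo_fin_card {n m : ℕ} {V : Type} [Fintype V] (G : NMGraph n m V) :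
    ∃ H : NMGraph n m (Fin (Fintype.card V)), G.HomTo H := by
  let e := Fintype.equivFin V
  refine ⟨⟨G.und.comap e.symm, fun u v => G.lab (e.symm u) (e.symm v),
    fun u v h => G.lab_mem _ _ h, fun u v h => G.lab_conj _ _ h⟩, e, fun u v h => ?_⟩
  simpa using h

theorem nmChrom_le_nmChromGraph {n m : ℕ} {V : Type} [Fintype V] (G : NMGraph n m V) :
    nmChrom n m G ≤ nmChromGraph n m G.und := by
  refine le_csSup ⟨Fintype.card V, ?_⟩ ⟨G, rfl, rfl⟩
  rintro _ ⟨G', -, rfl⟩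
  exact Nat.sInf_le G'.exists_homTo_fin_card

theorem NMGraph.exists_map_fin {n m : ℕ} {V : Type} [Fintype V] (G : NMGraph n m V) {k : ℕ}
    (hk : nmChrom n m G ≤ k) :
    ∃ (f : V → Fin k) (L : Fin k → Fin k → ℕ), ∀ u v, G.und.Adj u v →
      f u ≠ f v ∧ L (f u) (f v) = G.lab u v := by
  obtain ⟨t, ht, H, f, hf⟩ : ∃ t ≤ k, ∃ H : NMGraph n m (Fin t), G.HomTo H :=
    ⟨_, hk, Nat.sInf_mem (s := {t | ∃ H : NMGraph n m (Fin t), G.HomTo H})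
      ⟨_, G.exists_homTo_fin_card⟩⟩
  refine ⟨fun u => Fin.castLE ht (f u), fun i j => if h : (i : ℕ) < t ∧ (j : ℕ) < t then
    H.lab ⟨i, h.1⟩ ⟨j, h.2⟩ else 0, fun u v h => ⟨?_, ?_⟩⟩
  · exact fun he => (hf u v h).1.ne (Fin.castLE_injective ht he)
  · simpa using (hf u v h).2

theorem pow_ncard_edgesIn_le {n m : ℕ} (hp : 0 < 2 * n + m) {V : Type} [Fintype V]
    (S : SimpleGraph V) (U : Set V) :
    (2 * n + m) ^ (S.edgesIn U).ncard ≤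
      nmChromGraph n m S ^ U.ncard * (2 * n + m) ^ (nmChromGraph n m S).choose 2 := by
  classical
  set k := nmChromGraph n m S with hk
  set p := 2 * n + m with hp'
  have : NeZero p := ⟨hp.ne'⟩
  let _ : LinearOrder V := LinearOrder.lift' (Fintype.equivFin V) (Equiv.injective _)
  let ext (a : S.edgesIn U → Fin p) (e : Sym2 V) : Fin p :=
    if h : e ∈ S.edgesIn U then a ⟨e, h⟩ else 0
  have hmap (a : S.edgesIn U → Fin p) :=
    (NMGraph.ofLabels S (ext a)).exists_map_fin (nmChrom_le_nmChromGraph _)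
  choose f L hfL using hmap
  let code (a : S.edgesIn U → Fin p) :
      (U → Fin k) × ((Σ j : Fin k, Fin j) → Fin p) :=
    (fun u => f a u, fun x => Fin.ofNat p (L a (Fin.castLE x.1.2.le x.2) x.1 - 1))
  have hcode : Function.Injective code := by
    intro a b hab
    have hlab : ∀ u v, S.Adj u v → u ∈ U → v ∈ U → f a u < f a v →
        ext a s(u, v) = ext b s(u, v) := by
      intro u v huv hu hv hlt
      have hfu : f a u = f b u := congrFun (congrArg Prod.fst hab) ⟨u, hu⟩
      have hfv : f a v = f b v := congrFun (congrArg Prod.fst hab) ⟨v, hv⟩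
      have hL := congrFun (congrArg Prod.snd hab) ⟨f a v, ⟨f a u, hlt⟩⟩
      have h1 := (hfL a u v huv).2
      have h2 := (hfL b u v huv).2
      rw [← hfu, ← hfv] at h2
      change Fin.ofNat p (L a (f a u) (f a v) - 1) = Fin.ofNat p (L b (f a u) (f a v) - 1) at hL
      rw [h1, h2] at hL
      have m1 := (NMGraph.ofLabels S (ext a)).lab_mem u v huv
      have m2 := (NMGraph.ofLabels S (ext b)).lab_mem u v huv
      have hL := congrArg Fin.val hL
      simp only [Fin.ofNat] at hL
      rw [Nat.mod_eq_of_lt (by omega), Nat.mod_eq_of_lt (by omega)] at hL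
      exact NMGraph.ofLabels_lab_inj (S := S) (by omega)
    have hext : ∀ u v, S.Adj u v → u ∈ U → v ∈ U → ext a s(u, v) = ext b s(u, v) := by
      intro u v huv hu hv
      rcases lt_or_gt_of_ne (hfL a u v huv).1 with h | h
      · exact hlab u v huv hu hv h
      · rw [Sym2.eq_swap]
        exact hlab v u huv.symm hv hu h
    funext ⟨e, he⟩
    induction e with | _ u v
    simpa [ext, he] using hext u v he.1 (he.2 u (by simp)) (he.2 v (by simp))
  have hcard := Fintype.card_le_of_injective code hcode
  simp only [Fintype.card_prod, Fintype.card_fun, Fintype.card_fin, Fintype.card_sigma,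
    Fin.sum_univ_eq_sum_range (fun i => i), Finset.sum_range_id, ← Nat.choose_two_right] at hcard
  simpa only [← Nat.card_eq_fintype_card, Nat.card_coe_set_eq] using hcard

theorem sq_le_two_pow {k : ℕ} (hk : k ≠ 3) : k ^ 2 ≤ 2 ^ k := by
  rcases lt_or_ge k 4 with h | h
  · interval_cases k <;> simp_all
  · induction k, h using Nat.le_induction with
    | base => norm_num
    | succ k h ih =>
      have := ih (by omega)
      rw [pow_succ 2 k]
      nlinarith

theorem logb_le_half {p k : ℕ} (hp : 2 ≤ p) (h : k ≠ 3 ∨ 3 ≤ p) :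
    Real.logb p k ≤ (k : ℝ) / 2 := by
  obtain rfl | hk := Nat.eq_zero_or_pos k
  · simp
  have hle : k ^ 2 ≤ p ^ k := by
    by_cases hk3 : k = 3
    · subst hk3
      calc 3 ^ 2 ≤ 3 ^ 3 := by norm_num
        _ ≤ p ^ 3 := Nat.pow_le_pow_left (by omega) _
    · exact (sq_le_two_pow hk3).trans (Nat.pow_le_pow_left hp _)
  have hp1 : (1 : ℝ) < p := by exact_mod_cast hp
  have hlog : Real.logb p ((k : ℝ) ^ 2) ≤ k := by
    rw [Real.logb_le_iff_le_rpow hp1 (by positivity), Real.rpow_natCast]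
    exact_mod_cast hle
  rw [Real.logb_pow] at hlog
  push_cast at hlog
  linarith

theorem le_mul_of_pow_le {p k v e r : ℕ} (hp : 2 ≤ p) (hv : 1 ≤ v) (hk : 1 ≤ k)
    (he : e ≤ v.choose 2) (hpow : p ^ e ≤ k ^ v * p ^ k.choose 2)
    (hr : Real.logb p k + (k : ℝ) / 2 ≤ r) : e ≤ r * (v - 1) := by
  have hp1 : (1 : ℝ) < p := by exact_mod_cast hp
  have hk0 : (0 : ℝ) < k := by exact_mod_cast hk
  have hL0 : 0 ≤ Real.logb p k := Real.logb_nonneg hp1 (by exact_mod_cast hk)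
  obtain ⟨w, rfl⟩ := Nat.exists_eq_add_of_le' hv
  suffices h : (e : ℝ) ≤ r * w by exact_mod_cast h
  have hw0 : (0 : ℝ) ≤ w := w.cast_nonneg
  rcases lt_or_ge w k with hwk | hwk
  · have he' : (e : ℝ) ≤ (w + 1) * w / 2 := by
      have : (e : ℝ) ≤ ((w + 1).choose 2 : ℕ) := by exact_mod_cast he
      rw [Nat.cast_choose_two] at this
      push_cast at this
      linarith
    have hwk' : (w + 1 : ℝ) ≤ k := by exact_mod_cast hwk
    nlinarith
  · have hwk' : (k : ℝ) ≤ w := by exact_mod_cast hwk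
    have hlog : (e : ℝ) ≤ (w + 1) * Real.logb p k + k * (k - 1) / 2 := by
      have h1 : (p : ℝ) ^ e ≤ (k : ℝ) ^ (w + 1) * (p : ℝ) ^ k.choose 2 := by exact_mod_cast hpow
      have h2 := Real.logb_le_logb_of_le hp1 (by positivity) h1
      rw [Real.logb_mul (by positivity) (by positivity), Real.logb_pow, Real.logb_pow,
        Real.logb_pow, Real.logb_self_eq_one hp1, Nat.cast_choose_two] at h2
      push_cast at h2
      linarith
    by_cases hex : k ≠ 3 ∨ 3 ≤ p
    · have := logb_le_half hp hex
      nlinarith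
    · obtain ⟨rfl, rfl⟩ : k = 3 ∧ p = 2 := by omega
      have h1 : (3 : ℝ) / 2 < Real.logb (2 : ℕ) (3 : ℕ) := by
        have : (3 : ℝ) < Real.logb (2 : ℕ) ((3 : ℕ) ^ 2 : ℝ) := by
          rw [Real.lt_logb_iff_rpow_lt hp1 (by positivity)]
          norm_num
        rw [Real.logb_pow] at this
        push_cast at this ⊢
        linarith
      have h2 : Real.logb (2 : ℕ) (3 : ℕ) ≤ 2 := by
        rw [Real.logb_le_iff_le_rpow hp1 (by positivity)]
        norm_num
      have hr4 : (4 : ℝ) ≤ r := by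
        have : (3 : ℝ) < r := by
          push_cast at hr h1
          linarith
        exact_mod_cast this
      push_cast at *
      nlinarith

/-- If `χ_{n,m}(G) = k`, then `arb(G) ≤ ⌈log_{2n+m} k + k/2⌉`. -/
theorem arboricity_le_of_nmChrom (n m : ℕ) (hp : 2 ≤ 2 * n + m)
    {V : Type} [Fintype V] (S : SimpleGraph V) (k : ℕ)
    (hk : nmChromGraph n m S = k) :
    (arboricity S : ℤ) ≤ ⌈Real.logb (2 * n + m) k + (k : ℝ) / 2⌉ := by
  have hpcast : (2 * n + m : ℝ) = ((2 * n + m : ℕ) : ℝ) := by push_cast; ring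
  have hp1 : (1 : ℝ) < (2 * n + m : ℕ) := by exact_mod_cast hp
  rw [hpcast]
  set x := Real.logb (2 * n + m : ℕ) k + (k : ℝ) / 2 with hx
  have hx0 : 0 ≤ x := by
    obtain rfl | hk0 := Nat.eq_zero_or_pos k
    · simp [hx]
    · have := Real.logb_nonneg hp1 (x := k) (by exact_mod_cast hk0)
      positivity
  obtain ⟨r, hr⟩ := Int.eq_ofNat_of_zero_le (Int.ceil_nonneg hx0)
  rw [hr]
  have hxr : x ≤ r := by
    have := Int.le_ceil x
    rw [hr] at this
    exact_mod_cast this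
  refine Int.ofNat_le.2 (arboricity_le S r fun U hU => ?_)
  have hUpos : 1 ≤ U.ncard := (Set.ncard_pos (Set.toFinite _)).2 hU
  have hpow := pow_ncard_edgesIn_le (n := n) (m := m) (by omega) S U
  rw [hk] at hpow
  refine le_mul_of_pow_le hp hUpos ?_ (S.ncard_edgesIn_le_choose_two U) hpow hxr
  by_contra! h0
  obtain rfl : k = 0 := by omega
  rw [zero_pow (by omega), Nat.zero_mul, Nat.le_zero] at hpow
  exact (pow_pos (by omega) _).ne' hpow
end

section
/- Let n, m ≥ 0 be integers with (n,m) ≠ (0,1), and let F be a complete family of finite simple graphs whose (n,m)-chromatic number χ_{n,m}(F) is finite. Then there exists a minimal (n,m)-universal bound of F having exactly χ_{n,m}(F) vertices. -/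
open SimpleGraph

/-- The subgraph of an `(n,m)`-graph `T` determined by a vertex set `s` and a
spanning collection of edges `H ≤ T.und`, keeping the inherited labels. -/
def NMGraph.restrict {n m : ℕ} {W : Type} (T : NMGraph n m W) (s : Set W)
    (H : SimpleGraph W) (hle : H ≤ T.und) : NMGraph n m {x : W // x ∈ s} where
  und := SimpleGraph.comap Subtype.val H
  lab := fun u v => T.lab u.1 v.1
  lab_mem := fun u v h => T.lab_mem u.1 v.1 (hle h)
  lab_conj := fun u v h => T.lab_conj u.1 v.1 (hle h)

/-- A complete family of (finite) graphs: any finite collection of members can be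
found as pairwise vertex-disjoint subgraphs of a single member. -/
def CompleteFamily (F : Set ((N : ℕ) × SimpleGraph (Fin N))) : Prop :=
  ∀ (k : ℕ) (Gs : Fin k → (N : ℕ) × SimpleGraph (Fin N)),
    (∀ i, Gs i ∈ F) →
    ∃ U ∈ F, ∃ f : ∀ i, (Gs i).2 →g U.2,
      (∀ i, Function.Injective (f i)) ∧
      (∀ i j, i ≠ j → ∀ x y, f i x ≠ f j y)

/-- The `(n,m)`-chromatic number of a family of graphs. -/
noncomputable def nmChromFam (n m : ℕ) (F : Set ((N : ℕ) × SimpleGraph (Fin N))) : ℕ :=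
  sSup {k | ∃ (N : ℕ) (G : NMGraph n m (Fin N)),
    (⟨N, G.und⟩ : (N : ℕ) × SimpleGraph (Fin N)) ∈ F ∧ nmChrom n m G = k}

/-- `T` is an `(n,m)`-universal bound of the family `F`. -/
def IsUnivBoundFam (n m : ℕ) (F : Set ((N : ℕ) × SimpleGraph (Fin N)))
    {W : Type} (T : NMGraph n m W) : Prop :=
  ∀ (N : ℕ) (G : NMGraph n m (Fin N)),
    (⟨N, G.und⟩ : (N : ℕ) × SimpleGraph (Fin N)) ∈ F → G.HomTo T

/-- `T` is a minimal `(n,m)`-universal bound of `F`: it is a universal bound of `F`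
and no proper subgraph of `T` is one. -/
def IsMinUnivBoundFam (n m : ℕ) (F : Set ((N : ℕ) × SimpleGraph (Fin N)))
    {W : Type} (T : NMGraph n m W) : Prop :=
  IsUnivBoundFam n m F T ∧
  ∀ (s : Set W) (H : SimpleGraph W) (hle : H ≤ T.und),
    (s ≠ Set.univ ∨ H ≠ T.und) → ¬ IsUnivBoundFam n m F (T.restrict s H hle)

namespace NMGraph

variable {n m : ℕ}

theorem HomTo.trans {U V W : Type} {G : NMGraph n m U} {H : NMGraph n m V} {K : NMGraph n m W}
    (h₁ : G.HomTo H) (h₂ : H.HomTo K) : G.HomTo K := by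
  obtain ⟨f, hf⟩ := h₁
  obtain ⟨g, hg⟩ := h₂
  refine ⟨g ∘ f, fun u v h => ?_⟩
  obtain ⟨h₁, h₂⟩ := hf u v h
  obtain ⟨h₃, h₄⟩ := hg _ _ h₁
  exact ⟨h₃, h₄.trans h₂⟩

/-- The image of an `(n,m)`-graph under an injective vertex map. -/
noncomputable def map {V W : Type} (G : NMGraph n m V) (f : V ↪ W) : NMGraph n m W where
  und := G.und.map f
  lab := fun a b => Function.extend f (fun x => Function.extend f (G.lab x) 0 b) 0 a
  lab_mem := by
    rintro _ _ ⟨-, x, y, h, rfl, rfl⟩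
    simpa only [f.injective.extend_apply] using G.lab_mem x y h
  lab_conj := by
    rintro _ _ ⟨-, x, y, h, rfl, rfl⟩
    simpa only [f.injective.extend_apply] using G.lab_conj x y h

theorem homTo_map {V W : Type} (G : NMGraph n m V) (f : V ↪ W) : G.HomTo (G.map f) :=
  ⟨f, fun u v h => ⟨(SimpleGraph.map_adj_apply (f := f)).2 h, by
    simp only [map, f.injective.extend_apply]⟩⟩

theorem exists_homTo_fin {V : Type} [Finite V] (G : NMGraph n m V) {t : ℕ} (ht : Nat.card V ≤ t) :
    ∃ H : NMGraph n m (Fin t), G.HomTo H :=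
  ⟨_, G.homTo_map ((Finite.equivFin V).toEmbedding.trans (Fin.castLEEmb ht))⟩

theorem exists_homTo_fin_of_nmChrom_le {V : Type} [Finite V] (G : NMGraph n m V) {t : ℕ}
    (ht : nmChrom n m G ≤ t) : ∃ H : NMGraph n m (Fin t), G.HomTo H := by
  have hmem : nmChrom n m G ∈ {t | ∃ H : NMGraph n m (Fin t), G.HomTo H} :=
    Nat.sInf_mem ⟨_, G.exists_homTo_fin le_rfl⟩
  obtain ⟨H, hH⟩ := hmem
  exact ⟨_, hH.trans (H.homTo_map (Fin.castLEEmb ht))⟩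

theorem nmChrom_le_card {V W : Type} [Finite W] {G : NMGraph n m V} {T : NMGraph n m W}
    (h : G.HomTo T) : nmChrom n m G ≤ Nat.card W := by
  obtain ⟨H, hH⟩ := T.exists_homTo_fin le_rfl
  exact Nat.sInf_le ⟨H, h.trans hH⟩

open Classical in
/-- Up to labels of non-adjacent pairs, there are finitely many `(n,m)`-graphs on `V`. -/
theorem exists_finite_representatives (n m : ℕ) (V : Type) [Finite V] :
    ∃ (k : ℕ) (R : Fin k → NMGraph n m V), ∀ T : NMGraph n m V, ∃ i, T.HomTo (R i) := by
  let code : NMGraph n m V → SimpleGraph V × (V → V → Fin (2 * n + m + 1)) := fun T =>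
    (T.und, fun u v => if h : T.und.Adj u v then
      ⟨T.lab u v, Nat.lt_succ_of_le (T.lab_mem u v h).2⟩ else 0)
  obtain ⟨k, ⟨e⟩⟩ := Finite.exists_equiv_fin (Set.range code)
  choose rep hrep using fun c : Set.range code => c.2
  refine ⟨k, fun i => rep (e.symm i), fun T =>
    ⟨e ⟨code T, Set.mem_range_self T⟩, id, fun u v h => ?_⟩⟩
  simp only [e.symm_apply_apply, id_eq]
  have hc := hrep ⟨code T, Set.mem_range_self T⟩
  generalize rep ⟨code T, Set.mem_range_self T⟩ = S at hc
  have h₁ : S.und = T.und := congrArg Prod.fst hc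
  have hS : S.und.Adj u v := h₁ ▸ h
  have h₂ := congrFun (congrFun (congrArg Prod.snd hc) u) v
  simp only [code, dif_pos h, dif_pos hS, Fin.mk.injEq] at h₂
  exact ⟨hS, h₂⟩

/-- Labellings of pairwise disjoint subgraphs extend to a labelling of the whole graph. -/
theorem exists_common_extension (hnm : 0 < 2 * n + m) {ι V : Type} [LinearOrder V]
    {M : ι → Type} (U : SimpleGraph V) (G : ∀ i, NMGraph n m (M i))
    (f : ∀ i, (G i).und →g U) (hinj : ∀ i, Function.Injective (f i))
    (hdisj : ∀ i j, i ≠ j → ∀ x y, f i x ≠ f j y) :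
    ∃ L : NMGraph n m V, L.und = U ∧ ∀ i, (G i).HomTo L := by
  have key : ∀ u v, ∃ l, (∀ i x y, f i x = u → f i y = v → (G i).und.Adj x y →
      l = (G i).lab x y) ∧ ((¬ ∃ i x y, f i x = u ∧ f i y = v ∧ (G i).und.Adj x y) →
      l = if n = 0 then 1 else if u < v then 1 else 2) := by
    intro u v
    by_cases h : ∃ i x y, f i x = u ∧ f i y = v ∧ (G i).und.Adj x y
    · obtain ⟨i, x, y, rfl, rfl, hxy⟩ := h
      refine ⟨(G i).lab x y, fun j x' y' hx hy _ => ?_, fun h => (h ⟨i, x, y, rfl, rfl, hxy⟩).elim⟩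
      obtain rfl : j = i := by_contra fun hji => hdisj j i hji _ _ hx
      rw [hinj _ hx, hinj _ hy]
    · exact ⟨_, fun i x y hx hy hxy => (h ⟨i, x, y, hx, hy, hxy⟩).elim, fun _ => rfl⟩
  choose lab hlab hbase using key
  refine ⟨⟨U, lab, fun u v huv => ?_, fun u v huv => ?_⟩, rfl, fun i => ⟨f i, fun x y h =>
    ⟨(f i).map_adj h, hlab _ _ i x y rfl rfl h⟩⟩⟩
  · by_cases h : ∃ i x y, f i x = u ∧ f i y = v ∧ (G i).und.Adj x y
    · obtain ⟨i, x, y, hx, hy, hxy⟩ := h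
      rw [hlab u v i x y hx hy hxy]
      exact (G i).lab_mem x y hxy
    · rw [hbase u v h]
      split_ifs <;> omega
  · by_cases h : ∃ i x y, f i x = u ∧ f i y = v ∧ (G i).und.Adj x y
    · obtain ⟨i, x, y, hx, hy, hxy⟩ := h
      rw [hlab u v i x y hx hy hxy, hlab v u i y x hy hx hxy.symm]
      exact (G i).lab_conj x y hxy
    · have h' : ¬ ∃ i x y, f i x = v ∧ f i y = u ∧ (G i).und.Adj x y :=
        fun ⟨i, x, y, hx, hy, hxy⟩ => h ⟨i, y, x, hy, hx, hxy.symm⟩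
      rw [hbase u v h, hbase v u h']
      rcases lt_or_gt_of_ne huv.ne with hlt | hlt
      · simp only [hlt, hlt.not_gt, conjLab, if_true, if_false]
        split_ifs <;> omega
      · simp only [hlt, hlt.not_gt, conjLab, if_true, if_false]
        split_ifs <;> omega

end NMGraph

/-- If every labelling of every member of a complete family maps to some `(n,m)`-graph on `V`,
then a single `(n,m)`-graph on `V` is a universal bound. -/
theorem CompleteFamily.exists_isUnivBoundFam {n m : ℕ} {F : Set ((N : ℕ) × SimpleGraph (Fin N))}
    (hF : CompleteFamily F) {V : Type} [Finite V]
    (hV : ∀ (N : ℕ) (G : NMGraph n m (Fin N)),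
      (⟨N, G.und⟩ : (N : ℕ) × SimpleGraph (Fin N)) ∈ F → ∃ T : NMGraph n m V, G.HomTo T) :
    ∃ T : NMGraph n m V, IsUnivBoundFam n m F T := by
  rcases Nat.eq_zero_or_pos (2 * n + m) with h0 | hpos
  · have hno : ∀ {W : Type} (G : NMGraph n m W) u v, ¬ G.und.Adj u v := fun G u v h => by
      have := G.lab_mem u v h
      omega
    refine ⟨⟨⊥, fun _ _ => 0, fun _ _ h => h.elim, fun _ _ h => h.elim⟩, fun N G hG => ?_⟩
    obtain ⟨-, f, -⟩ := hV N G hG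
    exact ⟨f, fun u v h => (hno G u v h).elim⟩
  · obtain ⟨k, R, hR⟩ := NMGraph.exists_finite_representatives n m V
    by_contra! hcon
    have hbad : ∀ i, ∃ (N : ℕ) (G : NMGraph n m (Fin N)),
        (⟨N, G.und⟩ : (N : ℕ) × SimpleGraph (Fin N)) ∈ F ∧ ¬ G.HomTo (R i) := fun i => by
      simpa [IsUnivBoundFam] using hcon (R i)
    choose N G hG hGR using hbad
    obtain ⟨⟨M, U⟩, hU, f, hinj, hdisj⟩ := hF k (fun i => ⟨N i, (G i).und⟩) hG
    obtain ⟨L, rfl, hL⟩ := NMGraph.exists_common_extension hpos U G f hinj hdisj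
    obtain ⟨T, hT⟩ := hV M L hU
    obtain ⟨i, hi⟩ := hR T
    exact hGR i ((hL i).trans (hT.trans hi))

/-- For a complete family `F` of graphs with finite `(n,m)`-chromatic number, there
exists a minimal `(n,m)`-universal bound of `F` on exactly `χ_{n,m}(F)` vertices. -/
theorem exists_minimal_universal_bound (n m : ℕ) (hnm : (n, m) ≠ (0, 1))
    (F : Set ((N : ℕ) × SimpleGraph (Fin N))) (hF : CompleteFamily F)
    (hfin : BddAbove {k | ∃ (N : ℕ) (G : NMGraph n m (Fin N)),
      (⟨N, G.und⟩ : (N : ℕ) × SimpleGraph (Fin N)) ∈ F ∧ nmChrom n m G = k}) :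
    ∃ T : NMGraph n m (Fin (nmChromFam n m F)), IsMinUnivBoundFam n m F T := by
  obtain ⟨T₀, hT₀⟩ := hF.exists_isUnivBoundFam (V := Fin (nmChromFam n m F)) (n := n) (m := m)
    fun N G hG => G.exists_homTo_fin_of_nmChrom_le (le_csSup hfin ⟨N, G, hG, rfl⟩)
  obtain ⟨_, ⟨T, hT, rfl⟩, hmin⟩ :=
    (wellFounded_lt (α := SimpleGraph (Fin (nmChromFam n m F)))).has_min
    {K | ∃ T : NMGraph n m (Fin (nmChromFam n m F)), IsUnivBoundFam n m F T ∧ T.und = K}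
    ⟨_, T₀, hT₀, rfl⟩
  refine ⟨T, hT, fun s H hle hne hbound => ?_⟩
  by_cases hs : s = Set.univ
  · have hH : H ≠ T.und := hne.resolve_left (not_not_intro hs)
    let T' : NMGraph n m (Fin (nmChromFam n m F)) :=
      ⟨H, T.lab, fun u v h => T.lab_mem u v (hle h), fun u v h => T.lab_conj u v (hle h)⟩
    have hT' : (T.restrict s H hle).HomTo T' := ⟨Subtype.val, fun _ _ h => ⟨h, rfl⟩⟩
    exact hmin H ⟨T', fun N G hG => (hbound N G hG).trans hT', rfl⟩ (lt_of_le_of_ne hle hH)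
  · have hle' : nmChromFam n m F ≤ s.ncard := csSup_le' <| by
      rintro _ ⟨N, G, hG, rfl⟩
      exact NMGraph.nmChrom_le_card (hbound N G hG)
    have hlt := Set.ncard_lt_card hs
    rw [Nat.card_fin] at hlt
    omega
end

section
/- Let T_2 denote the family of partial 2-trees. Then 14 ≤ χ_{0,3}(T_2) ≤ 15; that is, every (0,3)-graph whose underlying graph is a partial 2-tree admits a homomorphism to some (0,3)-graph on 15 vertices, and there exists a (0,3)-graph whose underlying graph is a partial 2-tree that admits no homomorphism to any (0,3)-graph on at most 13 vertices. -/
open SimpleGraph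

/-- The 2-tree extension: add a new vertex adjacent to both endpoints of the edge `uv`. -/
def addVertex {N : ℕ} (G : SimpleGraph (Fin N)) (u v : Fin N) : SimpleGraph (Fin (N + 1)) :=
  SimpleGraph.fromRel (fun a b =>
    (∃ a' b', a = Fin.castSucc a' ∧ b = Fin.castSucc b' ∧ G.Adj a' b') ∨
    (a = Fin.last N ∧ (b = Fin.castSucc u ∨ b = Fin.castSucc v)))

/-- 2-trees: `K₂` is a 2-tree, and adding a new vertex adjacent to the two endpoints
of an existing edge of a 2-tree yields a 2-tree. -/
inductive Is2Tree : (N : ℕ) → SimpleGraph (Fin N) → Prop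
  | base : Is2Tree 2 ⊤
  | extend {N : ℕ} {G : SimpleGraph (Fin N)} (u v : Fin N) (huv : G.Adj u v)
      (h : Is2Tree N G) : Is2Tree (N + 1) (addVertex G u v)

/-- A partial 2-tree: a graph isomorphic to a subgraph of some 2-tree. -/
def IsPartial2Tree {V : Type} (G : SimpleGraph V) : Prop :=
  ∃ (N : ℕ) (T : SimpleGraph (Fin N)) (f : G →g T), Is2Tree N T ∧ Function.Injective f

section UpperBound

variable {N : ℕ} {G : SimpleGraph (Fin N)} {u v : Fin N}

@[simp] lemma addVertex_adj_castSucc_castSucc {a b : Fin N} :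
    (addVertex G u v).Adj a.castSucc b.castSucc ↔ G.Adj a b := by
  simp only [addVertex, SimpleGraph.fromRel_adj, Fin.castSucc_inj, Fin.castSucc_ne_last,
    false_and, or_false]
  constructor
  · rintro ⟨-, ⟨a', b', rfl, rfl, h⟩ | ⟨a', b', rfl, rfl, h⟩⟩
    exacts [h, h.symm]
  · exact fun h => ⟨fun hab => h.ne (Fin.castSucc_injective _ hab), Or.inl ⟨a, b, rfl, rfl, h⟩⟩

@[simp] lemma addVertex_adj_last_castSucc {a : Fin N} :
    (addVertex G u v).Adj (Fin.last N) a.castSucc ↔ a = u ∨ a = v := by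
  simp [addVertex, SimpleGraph.fromRel_adj, (Fin.castSucc_ne_last _).symm]

@[simp] lemma addVertex_adj_castSucc_last {a : Fin N} :
    (addVertex G u v).Adj a.castSucc (Fin.last N) ↔ a = u ∨ a = v := by
  rw [SimpleGraph.adj_comm, addVertex_adj_last_castSucc]

/-- The edge labels of a `(0,3)`-graph on `ℤ/15`, with `0` marking non-adjacency. Translation
by `1` is an automorphism up to a cyclic shift of the three labels. -/
def targetLab (x y : Fin 15) : ℕ :=
  let b := (![0, 1, 1, 3, 1, 0, 2, 2, 1, 2, 0, 3, 3, 2, 3] : Fin 15 → ℕ) (y - x)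
  if b = 0 then 0 else (b + x - 1) % 3 + 1

lemma targetLab_self (x : Fin 15) : targetLab x x = 0 := by
  simp [targetLab]

lemma targetLab_comm : ∀ x y : Fin 15, targetLab x y = targetLab y x := by
  decide +kernel

lemma targetLab_le (x y : Fin 15) : targetLab x y ≤ 3 := by
  unfold targetLab
  dsimp only
  split_ifs <;> omega

lemma exists_targetLab_eq : ∀ x y : Fin 15, targetLab x y ≠ 0 →
    ∀ a ∈ Finset.Icc 1 3, ∀ b ∈ Finset.Icc 1 3, ∃ z, targetLab x z = a ∧ targetLab y z = b := by
  decide +kernel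

lemma conjLab_zero (k : ℕ) : conjLab 0 k = k := by
  unfold conjLab
  split_ifs <;> omega

/-- The 15-vertex `(0,3)`-graph with labels `targetLab`. -/
def target : NMGraph 0 3 (Fin 15) where
  und :=
    { Adj := fun x y => targetLab x y ≠ 0
      symm := ⟨fun x y h => by rwa [targetLab_comm]⟩
      loopless := ⟨fun x h => h (targetLab_self x)⟩ }
  lab := targetLab
  lab_mem x y h := ⟨Nat.one_le_iff_ne_zero.2 h, targetLab_le x y⟩
  lab_conj x y _ := by rw [conjLab_zero, targetLab_comm]

lemma Is2Tree.exists_targetLab_eq {N : ℕ} {T : SimpleGraph (Fin N)} (h : Is2Tree N T)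
    (lab : Fin N → Fin N → ℕ) (hlab : ∀ u v, T.Adj u v → lab u v ∈ Finset.Icc 1 3)
    (hsymm : ∀ u v, T.Adj u v → lab u v = lab v u) :
    ∃ f : Fin N → Fin 15, ∀ u v, T.Adj u v → targetLab (f u) (f v) = lab u v := by
  induction h with
  | base =>
    have h01 := hlab 0 1 (by simp)
    obtain ⟨z, hz, -⟩ := _root_.exists_targetLab_eq 0 1 (by decide) _ h01 _ h01
    refine ⟨![0, z], fun u v huv => ?_⟩
    fin_cases u <;> fin_cases v
    · simp at huv
    · simpa using hz
    · rw [targetLab_comm, hsymm _ _ huv]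
      simpa using hz
    · simp at huv
  | @extend N G u v huv h ih =>
    obtain ⟨f, hf⟩ := ih (fun a b => lab a.castSucc b.castSucc)
      (fun a b hab => hlab _ _ (by simpa using hab))
      (fun a b hab => hsymm _ _ (by simpa using hab))
    obtain ⟨z, hzu, hzv⟩ := _root_.exists_targetLab_eq (f u) (f v)
      (by
        have := Finset.mem_Icc.1 (hlab u.castSucc v.castSucc (by simpa using huv))
        have := hf u v huv
        omega)
      _ (hlab u.castSucc (Fin.last N) (by simp)) _ (hlab v.castSucc (Fin.last N) (by simp))
    refine ⟨Fin.lastCases z f, fun a b hab => ?_⟩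
    have key : ∀ a : Fin N, a = u ∨ a = v →
        targetLab (f a) z = lab a.castSucc (Fin.last N) := by
      rintro a (rfl | rfl) <;> assumption
    induction a using Fin.lastCases with
    | last =>
      induction b using Fin.lastCases with
      | last => simp at hab
      | cast b =>
        rw [hsymm _ _ hab, targetLab_comm]
        simpa using key b (by simpa using hab)
    | cast a =>
      induction b using Fin.lastCases with
      | last => simpa using key a (by simpa using hab)
      | cast b => simpa using hf a b (by simpa using hab)

lemma NMGraph.homTo_target {V : Type} (G : NMGraph 0 3 V) (hG : IsPartial2Tree G.und) :
    G.HomTo target := by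
  classical
  obtain ⟨N, T, f, hT, hf⟩ := hG
  have hmem : ∀ u v, G.und.Adj u v → G.lab u v ∈ Finset.Icc 1 3 := fun u v h => by
    simpa using G.lab_mem u v h
  have hcomm : ∀ u v, G.und.Adj u v → G.lab u v = G.lab v u := fun u v h => by
    rw [G.lab_conj u v h, conjLab_zero]
  let lab : Fin N → Fin N → ℕ := fun a b =>
    if h : ∃ p : V × V, f p.1 = a ∧ f p.2 = b ∧ G.und.Adj p.1 p.2 then
      G.lab h.choose.1 h.choose.2 else 1
  have lab_eq : ∀ u v, G.und.Adj u v → lab (f u) (f v) = G.lab u v := fun u v huv => by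
    have h : ∃ p : V × V, f p.1 = f u ∧ f p.2 = f v ∧ G.und.Adj p.1 p.2 := ⟨(u, v), rfl, rfl, huv⟩
    have hs := h.choose_spec
    simp only [lab, dif_pos h]
    rw [hf hs.1, hf hs.2.1]
  have lab_cases : ∀ a b, (∃ u v, f u = a ∧ f v = b ∧ G.und.Adj u v) ∨
      lab a b = 1 ∧ lab b a = 1 := fun a b => by
    by_cases h : ∃ u v, f u = a ∧ f v = b ∧ G.und.Adj u v
    · exact Or.inl h
    · refine Or.inr ⟨dif_neg ?_, dif_neg ?_⟩
      · rintro ⟨p, h₁, h₂, h₃⟩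
        exact h ⟨_, _, h₁, h₂, h₃⟩
      · rintro ⟨p, h₁, h₂, h₃⟩
        exact h ⟨_, _, h₂, h₁, h₃.symm⟩
  obtain ⟨g, hg⟩ := hT.exists_targetLab_eq lab
    (fun a b _ => by
      obtain ⟨u, v, rfl, rfl, h⟩ | ⟨h, -⟩ := lab_cases a b
      · rw [lab_eq u v h]
        exact hmem u v h
      · simp [h])
    (fun a b _ => by
      obtain ⟨u, v, rfl, rfl, h⟩ | ⟨h, h'⟩ := lab_cases a b
      · rw [lab_eq u v h, lab_eq v u h.symm, hcomm u v h]
      · rw [h, h'])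
  refine ⟨g ∘ f, fun u v huv => ?_⟩
  have h : targetLab (g (f u)) (g (f v)) = G.lab u v := by
    rw [hg _ _ (f.map_adj huv), lab_eq u v huv]
  refine ⟨fun h0 => ?_, h⟩
  have := (G.lab_mem u v huv).1
  simp only [Function.comp_apply] at h0
  omega

end UpperBound

section LowerBound

lemma NMGraph.mem_nbr_comm {m : ℕ} {V : Type} {G : NMGraph 0 m V} {a : ℕ} {u v : V} :
    u ∈ G.nbr a v ↔ v ∈ G.nbr a u := by
  suffices h : ∀ u v, u ∈ G.nbr a v → v ∈ G.nbr a u from ⟨h u v, h v u⟩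
  rintro u v ⟨h, rfl⟩
  exact ⟨h.symm, by rw [G.lab_conj v u h, conjLab_zero]⟩

/-- `G` is extension-closed if every two adjacent vertices have a common neighbor realizing
each prescribed pair of labels. -/
def NMGraph.ExtensionClosed {V : Type} (G : NMGraph 0 3 V) : Prop :=
  ∀ u v, G.und.Adj u v → ∀ a ∈ Finset.Icc 1 3, ∀ b ∈ Finset.Icc 1 3,
    (G.nbr a u ∩ G.nbr b v).Nonempty

section Counting

open Finset

variable {V : Type} [Fintype V]

open Classical in
/-- `G.nbr a u` as a finset. -/
noncomputable def NMGraph.nbrFinset (G : NMGraph 0 3 V) (a : ℕ) (u : V) : Finset V :=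
  {v | v ∈ G.nbr a u}

@[simp] lemma NMGraph.mem_nbrFinset {G : NMGraph 0 3 V} {a : ℕ} {u v : V} :
    v ∈ G.nbrFinset a u ↔ v ∈ G.nbr a u := by
  simp [NMGraph.nbrFinset]

variable [DecidableEq V]

lemma NMGraph.sum_card_inter_nbrFinset_le (G : NMGraph 0 3 V) (S : Finset V) (y : V) :
    ∑ b ∈ Icc 1 3, #(S ∩ G.nbrFinset b y) ≤ #(S.erase y) := by
  rw [← card_biUnion]
  · refine card_le_card fun w hw => ?_
    simp only [mem_biUnion, mem_inter, NMGraph.mem_nbrFinset] at hw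
    obtain ⟨b, -, hS, hw⟩ := hw
    exact mem_erase.2 ⟨hw.1.ne', hS⟩
  · intro b _ c _ hbc
    refine disjoint_left.2 fun w hb hc => hbc ?_
    simp only [mem_inter, NMGraph.mem_nbrFinset] at hb hc
    exact hb.2.2.symm.trans hc.2.2

variable {G : NMGraph 0 3 V}

lemma NMGraph.ExtensionClosed.one_le_card (hG : G.ExtensionClosed) {x y : V}
    (hxy : G.und.Adj x y) {a b : ℕ} (ha : a ∈ Icc 1 3) (hb : b ∈ Icc 1 3) :
    1 ≤ #(G.nbrFinset a x ∩ G.nbrFinset b y) := by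
  obtain ⟨w, hw⟩ := hG x y hxy a ha b hb
  exact card_pos.2 ⟨w, by simpa using hw⟩

lemma NMGraph.sum_card_inter_nbrFinset_lt {a : ℕ} {x y : V} (hy : y ∈ G.nbr a x) :
    ∑ b ∈ Icc 1 3, #(G.nbrFinset a x ∩ G.nbrFinset b y) < #(G.nbrFinset a x) :=
  (G.sum_card_inter_nbrFinset_le _ y).trans_lt (card_erase_lt_of_mem (by simpa using hy))

lemma sum_Icc_one_three (f : ℕ → ℕ) : ∑ b ∈ Icc 1 3, f b = f 1 + f 2 + f 3 := by
  simp [show Icc 1 3 = {1, 2, 3} from rfl, add_assoc]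

lemma NMGraph.ExtensionClosed.four_le_card (hG : G.ExtensionClosed) {x y : V}
    (hxy : G.und.Adj x y) {a : ℕ} (ha : a ∈ Icc 1 3) : 4 ≤ #(G.nbrFinset a x) := by
  obtain ⟨z, hz, -⟩ := hG x y hxy a ha a ha
  have h := NMGraph.sum_card_inter_nbrFinset_lt hz
  rw [sum_Icc_one_three] at h
  have h1 := hG.one_le_card hz.1 ha (show 1 ∈ Icc 1 3 by simp)
  have h2 := hG.one_le_card hz.1 ha (show 2 ∈ Icc 1 3 by simp)
  have h3 := hG.one_le_card hz.1 ha (show 3 ∈ Icc 1 3 by simp)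
  omega

lemma NMGraph.ExtensionClosed.twelve_le_sum_card (hG : G.ExtensionClosed) {x y : V}
    (hxy : G.und.Adj x y) : 12 ≤ ∑ b ∈ Icc 1 3, #(G.nbrFinset b x) := by
  rw [sum_Icc_one_three]
  have h1 := hG.four_le_card hxy (show 1 ∈ Icc 1 3 by simp)
  have h2 := hG.four_le_card hxy (show 2 ∈ Icc 1 3 by simp)
  have h3 := hG.four_le_card hxy (show 3 ∈ Icc 1 3 by simp)
  omega

lemma NMGraph.ExtensionClosed.card_nbrFinset_one (hG : G.ExtensionClosed)
    (hV : Fintype.card V ≤ 13) {x y : V} (hxy : G.und.Adj x y) :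
    #(G.nbrFinset 1 x) = 4 ∧ Fintype.card V = 13 := by
  have h := G.sum_card_inter_nbrFinset_le univ x
  simp only [univ_inter, card_erase_of_mem (mem_univ x), card_univ] at h
  rw [sum_Icc_one_three] at h
  have h1 := hG.four_le_card hxy (show 1 ∈ Icc 1 3 by simp)
  have h2 := hG.four_le_card hxy (show 2 ∈ Icc 1 3 by simp)
  have h3 := hG.four_le_card hxy (show 3 ∈ Icc 1 3 by simp)
  omega

lemma NMGraph.ExtensionClosed.adj_of_ne (hG : G.ExtensionClosed)
    (hV : Fintype.card V ≤ 13) {x y z : V} (hxy : G.und.Adj x y) (hz : z ≠ x) :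
    G.und.Adj x z := by
  by_contra hxz
  have h := G.sum_card_inter_nbrFinset_le (univ.erase z) x
  have hsub : ∀ b, univ.erase z ∩ G.nbrFinset b x = G.nbrFinset b x := fun b =>
    inter_eq_right.2 fun w hw => by
      rw [NMGraph.mem_nbrFinset] at hw
      exact mem_erase.2 ⟨fun hwz => hxz (hwz ▸ hw.1), mem_univ _⟩
  simp only [hsub] at h
  rw [card_erase_of_mem (mem_erase.2 ⟨hz.symm, mem_univ _⟩), card_erase_of_mem (mem_univ z),
    card_univ] at h
  have := hG.twelve_le_sum_card hxy
  omega

/-- The graph formed by the edges of label `1`. -/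
def NMGraph.labelOne (G : NMGraph 0 3 V) : SimpleGraph V where
  Adj u v := v ∈ G.nbr 1 u
  symm := ⟨fun _ _ h => NMGraph.mem_nbr_comm.1 h⟩
  loopless := ⟨fun _ h => h.1.ne rfl⟩

/-- In an extension-closed graph on at most 13 vertices, all vertices have exactly four
`1`-neighbors and the graph of `1`-labelled edges is locally linear, so that `13 * 4 / 2` would
be divisible by `3`. -/
theorem NMGraph.ExtensionClosed.not_adj (hG : G.ExtensionClosed)
    (hV : Fintype.card V ≤ 13) (x y : V) : ¬ G.und.Adj x y := by
  classical
  intro hxy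
  have hdeg : ∀ z, #(G.nbrFinset 1 z) = 4 := fun z => by
    by_cases hz : z = x
    · exact hz ▸ (hG.card_nbrFinset_one hV hxy).1
    · exact (hG.card_nbrFinset_one hV (hG.adj_of_ne hV hxy hz).symm).1
  have hone : ∀ u v, v ∈ G.nbr 1 u → #(G.nbrFinset 1 u ∩ G.nbrFinset 1 v) = 1 := fun u v huv => by
    have h := NMGraph.sum_card_inter_nbrFinset_lt huv
    rw [sum_Icc_one_three, hdeg] at h
    have h1 := hG.one_le_card huv.1 (show 1 ∈ Icc 1 3 by simp) (show 1 ∈ Icc 1 3 by simp)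
    have h2 := hG.one_le_card huv.1 (show 1 ∈ Icc 1 3 by simp) (show 2 ∈ Icc 1 3 by simp)
    have h3 := hG.one_le_card huv.1 (show 1 ∈ Icc 1 3 by simp) (show 3 ∈ Icc 1 3 by simp)
    omega
  have hlin : G.labelOne.LocallyLinear := by
    refine ⟨fun s hs s' hs' hne => ?_, fun u v huv => ?_⟩
    · refine Set.not_nontrivial_iff.1 ?_
      rintro ⟨p, ⟨hp, hp'⟩, q, ⟨hq, hq'⟩, hpq⟩
      have hadj := hs.1 hp hq hpq
      obtain ⟨c, hc⟩ := card_eq_one.1 (hone p q hadj)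
      have key : ∀ s : Finset V, G.labelOne.IsNClique 3 s → p ∈ s → q ∈ s → s = {p, q, c} := by
        intro s hs hp hq
        refine eq_of_subset_of_card_le (fun r hr => ?_) (card_le_three.trans_eq hs.2.symm)
        simp only [mem_insert, mem_singleton, or_iff_not_imp_left]
        intro hrp hrq
        rw [← mem_singleton, ← hc]
        simp only [mem_inter, NMGraph.mem_nbrFinset]
        exact ⟨hs.1 hp hr (Ne.symm hrp), hs.1 hq hr (Ne.symm hrq)⟩
      exact hne ((key s hs hp hq).trans (key s' hs' hp' hq').symm)
    · obtain ⟨w, hw⟩ := hG u v huv.1 1 (by simp) 1 (by simp)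
      exact ⟨{u, v, w}, is3Clique_triple_iff.2 ⟨huv, hw.1, hw.2⟩, by simp, by simp⟩
  have hdegree : ∀ z, G.labelOne.degree z = 4 := fun z => by
    rw [← hdeg z, ← card_neighborFinset_eq_degree]
    congr 1
    ext w
    rw [mem_neighborFinset, NMGraph.mem_nbrFinset]
    rfl
  have hsum := G.labelOne.sum_degrees_eq_twice_card_edges
  simp only [hdegree, sum_const, card_univ, (hG.card_nbrFinset_one hV hxy).2, smul_eq_mul,
    hlin.card_edgeFinset] at hsum
  omega

end Counting

/-- `f` is a homomorphism from `G` to `H`. -/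
def NMGraph.IsHom {n m : ℕ} {V W : Type} (G : NMGraph n m V) (H : NMGraph n m W) (f : V → W) :
    Prop :=
  ∀ u v, G.und.Adj u v → H.und.Adj (f u) (f v) ∧ H.lab (f u) (f v) = G.lab u v

lemma NMGraph.IsHom.mem_nbr {n m : ℕ} {V W : Type} {G : NMGraph n m V} {H : NMGraph n m W}
    {f : V → W} (hf : G.IsHom H f) {a : ℕ} {u v : V} (h : v ∈ G.nbr a u) :
    f v ∈ H.nbr a (f u) :=
  ⟨(hf u v h.1).1, (hf u v h.1).2.trans h.2⟩

lemma NMGraph.IsHom.comp {n m : ℕ} {V W X : Type} {G : NMGraph n m V} {H : NMGraph n m W}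
    {K : NMGraph n m X} {g : W → X} {f : V → W} (hg : H.IsHom K g) (hf : G.IsHom H f) :
    G.IsHom K (g ∘ f) := fun u v h =>
  ⟨(hg _ _ (hf u v h).1).1, (hg _ _ (hf u v h).1).2.trans (hf u v h).2⟩

/-- Glue a new vertex onto the edge `uv`, joined to `u` with label `a` and to `v` with
label `b`. -/
def NMGraph.addVertex {N : ℕ} (G : NMGraph 0 3 (Fin N)) (u v : Fin N)
    (a b : ℕ) (ha : a ∈ Finset.Icc 1 3) (hb : b ∈ Finset.Icc 1 3) : NMGraph 0 3 (Fin (N + 1)) where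
  und := _root_.addVertex G.und u v
  lab := Fin.lastCases (Fin.lastCases 0 fun j => if j = u then a else b)
    fun i => Fin.lastCases (if i = u then a else b) fun j => G.lab i j
  lab_mem x y h := by
    rw [Finset.mem_Icc] at ha hb
    induction x using Fin.lastCases <;> induction y using Fin.lastCases
    · simp at h
    · simp only [Fin.lastCases_last, Fin.lastCases_castSucc]
      split_ifs <;> omega
    · simp only [Fin.lastCases_last, Fin.lastCases_castSucc]
      split_ifs <;> omega
    · simpa using G.lab_mem _ _ (by simpa using h)
  lab_conj x y h := by
    rw [conjLab_zero]
    induction x using Fin.lastCases <;> induction y using Fin.lastCases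
    · rfl
    · simp
    · simp
    · simpa [conjLab_zero] using G.lab_conj _ _ (by simpa using h)

lemma NMGraph.isHom_addVertex {N : ℕ} (G : NMGraph 0 3 (Fin N)) {u v : Fin N}
    {a b : ℕ} (ha : a ∈ Finset.Icc 1 3) (hb : b ∈ Finset.Icc 1 3) :
    G.IsHom (G.addVertex u v a b ha hb) Fin.castSucc := fun x y h => by
  simpa [NMGraph.addVertex] using h

lemma NMGraph.last_mem_nbr_addVertex {N : ℕ} (G : NMGraph 0 3 (Fin N)) {u v : Fin N}
    (huv : u ≠ v) {a b : ℕ} (ha : a ∈ Finset.Icc 1 3) (hb : b ∈ Finset.Icc 1 3) :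
    Fin.last N ∈ (G.addVertex u v a b ha hb).nbr a u.castSucc ∩
      (G.addVertex u v a b ha hb).nbr b v.castSucc := by
  simp [NMGraph.addVertex, NMGraph.nbr, huv.symm]

lemma NMGraph.exists_isHom_of_finset {N : ℕ} (G : NMGraph 0 3 (Fin N)) (hG : Is2Tree N G.und)
    (s : Finset ((Fin N × Fin N) × ℕ × ℕ)) :
    ∃ (M : ℕ) (K : NMGraph 0 3 (Fin M)) (e : Fin N → Fin M), Is2Tree M K.und ∧ G.IsHom K e ∧
      ∀ q ∈ s, G.und.Adj q.1.1 q.1.2 → q.2.1 ∈ Finset.Icc 1 3 → q.2.2 ∈ Finset.Icc 1 3 →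
        (K.nbr q.2.1 (e q.1.1) ∩ K.nbr q.2.2 (e q.1.2)).Nonempty := by
  induction s using Finset.induction_on with
  | empty => exact ⟨N, G, id, hG, fun _ _ h => ⟨h, rfl⟩, by simp⟩
  | insert q s _ ih =>
    obtain ⟨M, K, e, hK, he, hs⟩ := ih
    by_cases hq : G.und.Adj q.1.1 q.1.2 ∧ q.2.1 ∈ Finset.Icc 1 3 ∧ q.2.2 ∈ Finset.Icc 1 3
    · obtain ⟨hadj, ha, hb⟩ := hq
      have hadj' := (he _ _ hadj).1
      have hc := K.isHom_addVertex (u := e q.1.1) (v := e q.1.2) ha hb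
      refine ⟨M + 1, K.addVertex (e q.1.1) (e q.1.2) _ _ ha hb, Fin.castSucc ∘ e,
        Is2Tree.extend _ _ hadj' hK, hc.comp he, fun r hr hr' hra hrb => ?_⟩
      obtain rfl | hr := Finset.mem_insert.1 hr
      · exact ⟨_, K.last_mem_nbr_addVertex hadj'.ne ha hb⟩
      · obtain ⟨w, hw⟩ := hs r hr hr' hra hrb
        exact ⟨w.castSucc, hc.mem_nbr hw.1, hc.mem_nbr hw.2⟩
    · refine ⟨M, K, e, hK, he, fun r hr hr' hra hrb => ?_⟩
      obtain rfl | hr := Finset.mem_insert.1 hr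
      · exact absurd ⟨hr', hra, hrb⟩ hq
      · exact hs r hr hr' hra hrb

lemma NMGraph.exists_isHom_forall_nonempty {N : ℕ} (G : NMGraph 0 3 (Fin N))
    (hG : Is2Tree N G.und) :
    ∃ (M : ℕ) (K : NMGraph 0 3 (Fin M)) (e : Fin N → Fin M), Is2Tree M K.und ∧ G.IsHom K e ∧
      ∀ u v, G.und.Adj u v → ∀ a ∈ Finset.Icc 1 3, ∀ b ∈ Finset.Icc 1 3,
        (K.nbr a (e u) ∩ K.nbr b (e v)).Nonempty := by
  obtain ⟨M, K, e, hK, he, h⟩ := G.exists_isHom_of_finset hG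
    (Finset.univ ×ˢ Finset.Icc 1 3 ×ˢ Finset.Icc 1 3)
  exact ⟨M, K, e, hK, he, fun u v huv a ha b hb =>
    h ((u, v), a, b) (by simp only [Finset.mem_product]; exact ⟨Finset.mem_univ _, ha, hb⟩)
      huv ha hb⟩

/-- The ordered pairs of vertices that are images under `f` of the edges of `G`. -/
def edgeImage {V W : Type} (G : SimpleGraph V) (f : V → W) : Set (W × W) :=
  {p | ∃ u v, G.Adj u v ∧ (f u, f v) = p}

lemma Is2Tree.exists_adj {N : ℕ} {T : SimpleGraph (Fin N)} (h : Is2Tree N T) :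
    ∃ u v, T.Adj u v := by
  cases h with
  | base => exact ⟨0, 1, by simp⟩
  | @extend N G u v huv h => exact ⟨u.castSucc, v.castSucc, by simpa using huv⟩

/-- The subgraph of `H` with edge set `edgeImage G f`. -/
def NMGraph.IsHom.range {n m : ℕ} {V W : Type} {G : NMGraph n m V} {H : NMGraph n m W}
    {f : V → W} (hf : G.IsHom H f) : NMGraph n m W where
  und :=
    { Adj := fun x y => (x, y) ∈ edgeImage G.und f
      symm := ⟨by
        rintro _ _ ⟨u, v, huv, ⟨⟩⟩
        exact ⟨v, u, huv.symm, rfl⟩⟩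
      loopless := ⟨by
        rintro x ⟨u, v, huv, h⟩
        obtain ⟨hu, hv⟩ := Prod.mk.inj h
        exact (hf u v huv).1.ne (hu.trans hv.symm)⟩ }
  lab := H.lab
  lab_mem := by
    rintro _ _ ⟨u, v, huv, ⟨⟩⟩
    exact H.lab_mem _ _ (hf u v huv).1
  lab_conj := by
    rintro _ _ ⟨u, v, huv, ⟨⟩⟩
    exact H.lab_conj _ _ (hf u v huv).1

lemma NMGraph.IsHom.mem_nbr_range {n m : ℕ} {V W : Type} {G : NMGraph n m V}
    {H : NMGraph n m W} {f : V → W} (hf : G.IsHom H f) {a : ℕ} {u v : V} (h : v ∈ G.nbr a u) :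
    f v ∈ hf.range.nbr a (f u) :=
  ⟨⟨u, v, h.1, rfl⟩, (hf.mem_nbr h).2⟩

lemma exists_le_ncard_edgeImage (k : ℕ) : ∃ (N : ℕ) (G : NMGraph 0 3 (Fin N)), Is2Tree N G.und ∧
    ∀ t ≤ 13, ∀ (H : NMGraph 0 3 (Fin t)) (f : Fin N → Fin t), G.IsHom H f →
      k ≤ (edgeImage G.und f).ncard := by
  induction k with
  | zero =>
    exact ⟨2, ⟨⊤, fun _ _ => 1, by simp, by simp [conjLab_zero]⟩, Is2Tree.base, by simp⟩
  | succ k ih =>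
    obtain ⟨N, G, hG, hk⟩ := ih
    obtain ⟨M, K, e, hK, he, hext⟩ := G.exists_isHom_forall_nonempty hG
    refine ⟨M, K, hK, fun t ht H f hf => ?_⟩
    have hsub : edgeImage G.und (f ∘ e) ⊆ edgeImage K.und f := by
      rintro _ ⟨u, v, huv, rfl⟩
      exact ⟨e u, e v, (he u v huv).1, rfl⟩
    refine (hk t ht H _ (hf.comp he)).trans_lt (Set.ncard_lt_ncard (hsub.ssubset_of_ne ?_))
    intro heq
    have hclosed : hf.range.ExtensionClosed := by
      intro x y hxy a ha b hb
      obtain ⟨u, v, huv, h⟩ : (x, y) ∈ edgeImage G.und (f ∘ e) := heq ▸ hxy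
      obtain ⟨rfl, rfl⟩ := Prod.mk.inj h
      obtain ⟨w, hw⟩ := hext u v huv a ha b hb
      exact ⟨f w, hf.mem_nbr_range hw.1, hf.mem_nbr_range hw.2⟩
    obtain ⟨u, v, huv⟩ := hK.exists_adj
    exact hclosed.not_adj (by simpa using ht) (f u) (f v) ⟨u, v, huv, rfl⟩

end LowerBound

/-- `14 ≤ χ_{0,3}(T₂) ≤ 15`: every `(0,3)`-graph whose underlying graph is a
partial 2-tree admits a homomorphism to some `(0,3)`-graph on 15 vertices, and
there is a `(0,3)`-graph whose underlying graph is a partial 2-tree admitting no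
homomorphism to any `(0,3)`-graph on at most 13 vertices. -/
theorem nmChrom_partial2trees_zero_three :
    (∀ {V : Type} [Fintype V] (G : NMGraph 0 3 V), IsPartial2Tree G.und →
        ∃ H : NMGraph 0 3 (Fin 15), G.HomTo H) ∧
    (∃ (N : ℕ) (G : NMGraph 0 3 (Fin N)), IsPartial2Tree G.und ∧
        ∀ t : ℕ, t ≤ 13 → ∀ H : NMGraph 0 3 (Fin t), ¬ G.HomTo H) := by
  refine ⟨fun G hG => ⟨target, G.homTo_target hG⟩, ?_⟩
  obtain ⟨N, G, hG, h⟩ := exists_le_ncard_edgeImage (13 * 13 + 1)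
  refine ⟨N, G, ⟨N, G.und, SimpleGraph.Hom.id, hG, Function.injective_id⟩, ?_⟩
  rintro t ht H ⟨f, hf⟩
  have hle := h t ht H f hf
  have hcard := Set.ncard_le_card (edgeImage G.und f)
  simp only [Nat.card_prod, Nat.card_fin] at hcard
  have := Nat.mul_le_mul ht ht
  omega
end
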